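/- A (H,K_II)-linear Weingarten canal surface has a straight center curve: let a, b, d ∈ ℝ with b ≠ 0, suppose (EG − F²)(s,t) ≠ 0 and (eg − f²)(s,t) ≠ 0 for all (s,t), and a·H(s,t) + b·K_II(s,t) = d for all (s,t). Then κ(s) = 0 for all s. -/

import Mathlib

open scoped RealInnerProductSpace

/-- The numerator of the second Gaussian curvature of a canal surface, in terms of the radius data
`r` and its derivatives `p`, `ρ`, `σ`, of `k = κ √(1 - p²)`, of the logarithmic derivative `m` of
`k`, and of the torsion `τ`. -/
theorem canal_secondGaussian_numerator_algebra
    {r p ρ σ k m c sn τ Λ Λ₁ u ut utt us V Vt Vtt Vs W Wt Wtt Ws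
      e f g et es ett fs ft fst gs gss : ℝ}
    (hΛ₀ : Λ ≠ 0) (hcs : sn ^ 2 = 1 - c ^ 2)
    (hΛ : Λ = 1 - p ^ 2) (hΛ₁ : Λ₁ = -2 * p * ρ)
    (hu : u = ρ - k * c) (hut : ut = k * sn) (hutt : utt = k * c) (hus : us = σ - m * k * c)
    (hV : V = (Λ - r * u) * u) (hVt : Vt = (Λ - 2 * r * u) * ut)
    (hVtt : Vtt = (Λ - 2 * r * u) * utt - 2 * r * ut ^ 2)
    (hVs : Vs = (Λ - 2 * r * u) * us + (Λ₁ - p * u) * u)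
    (hW : W = p * (k * sn) + Λ * τ) (hWt : Wt = p * (k * c)) (hWtt : Wtt = -p * (k * sn))
    (he : e = V / Λ - r * W ^ 2 / Λ) (hf : f = r * W) (hg : g = -r * Λ)
    (het : et = Vt / Λ - r * (2 * W * Wt) / Λ)
    (hett : ett = Vtt / Λ - r * (2 * Wt * Wt + 2 * W * Wtt) / Λ)
    (hes : es = (Vs * Λ - V * Λ₁) / Λ ^ 2
      - ((p * W ^ 2 + r * (2 * W * Ws)) * Λ - r * W ^ 2 * Λ₁) / Λ ^ 2)
    (hfs : fs = p * W + r * Ws) (hft : ft = r * Wt)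
    (hfst : fst = p * Wt + r * ((ρ + p * m) * (k * c)))
    (hgs : gs = -(p * Λ + r * Λ₁))
    (hgss : gss = -(ρ * Λ + 2 * p * Λ₁ + r * (-2 * ρ ^ 2 - 2 * p * σ))) :
    Matrix.det !![-(1 / 2) * ett + fst - (1 / 2) * gss, (1 / 2) * es, fs - (1 / 2) * et;
          ft - (1 / 2) * gs, e, f;
          (1 / 2) * 0, f, g] -
        Matrix.det !![0, (1 / 2) * et, (1 / 2) * gs;
          (1 / 2) * et, e, f;
          (1 / 2) * gs, f, g]
      = -r ^ 3 * u ^ 4 + 3 / 2 * r ^ 2 * Λ * u ^ 3 - 1 / 4 * r * Λ ^ 2 * u ^ 2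
        + (1 / 2 * r * Λ * p ^ 2 * ρ + 1 / 4 * r * Λ ^ 2 * p * m - 1 / 2 * r * Λ ^ 2 * ρ
          + 1 / 4 * p ^ 2 * Λ ^ 2) * u
        + 1 / 4 * r * Λ ^ 2 * (p * (σ - m * ρ) - (k ^ 2 - ρ ^ 2))
        + 1 / 4 * r * Λ ^ 2 * p * k * τ * sn := by
  have h₁ : Matrix.det !![-(1 / 2) * ett + fst - (1 / 2) * gss, (1 / 2) * es, fs - (1 / 2) * et;
          ft - (1 / 2) * gs, e, f;
          (1 / 2) * 0, f, g] -
        Matrix.det !![0, (1 / 2) * et, (1 / 2) * gs;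
          (1 / 2) * et, e, f;
          (1 / 2) * gs, f, g]
      = -r * V * (-(1 / 2) * Vtt / Λ + r * (Wt ^ 2 + W * Wtt) / Λ + fst - gss / 2)
        + 1 / 2 * r * (r * Wt - gs / 2) * ((Vs * Λ - V * Λ₁) / Λ + W * Vt / Λ)
        - r * Vt ^ 2 / (4 * Λ) + (gs / 2) ^ 2 * V / Λ := by
    rw [Matrix.det_fin_three, Matrix.det_fin_three]
    subst e f g et ett es fs ft gs
    simp
    field_simp
    ring
  have h₂ : r * (Wt ^ 2 + W * Wtt) / Λ
      = r * (Wt ^ 2 - p ^ 2 * ut ^ 2) / Λ - r * p * k * τ * sn := by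
    subst W Wtt ut
    field_simp
    ring
  have h₃ : W * Vt / Λ
      = p * (Λ - 2 * r * u) * ut ^ 2 / Λ + (Λ - 2 * r * u) * k * τ * sn := by
    subst W Vt ut
    field_simp
  have h₄ : ut ^ 2 = k ^ 2 - (ρ - u) ^ 2 := by rw [hut, hu, mul_pow, hcs]; ring
  have h₅ : k * c = ρ - u := by rw [hu]; ring
  have h₆ : us = σ - m * (ρ - u) := by rw [hus, hu]; ring
  have h₇ : Vt ^ 2 = (Λ - 2 * r * u) ^ 2 * ut ^ 2 := by rw [hVt]; ring
  rw [h₁, h₂, h₃, h₇, hVtt, hVs, hutt, h₄, hgs, hgss, hV, hfst, h₆, hWt, h₅, hΛ₁]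
  rw [hΛ] at hΛ₀ ⊢
  field_simp
  ring

/-- A quartic in `ρ - k cos t` with `k ≠ 0` which vanishes for all `t` has vanishing top
coefficients. -/
theorem quartic_cos_coeff_eq_zero {ρ k A₀ A₁ A₂ A₃ A₄ : ℝ} (hk : k ≠ 0)
    (h : ∀ t : ℝ, A₄ * (ρ - k * Real.cos t) ^ 4 + A₃ * (ρ - k * Real.cos t) ^ 3
      + A₂ * (ρ - k * Real.cos t) ^ 2 + A₁ * (ρ - k * Real.cos t) + A₀ = 0) :
    A₂ = 0 ∧ A₃ = 0 ∧ A₄ = 0 := by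
  have hc : ∀ c : ℝ, -1 ≤ c → c ≤ 1 → A₄ * (ρ - k * c) ^ 4 + A₃ * (ρ - k * c) ^ 3
      + A₂ * (ρ - k * c) ^ 2 + A₁ * (ρ - k * c) + A₀ = 0 := fun c h₁ h₂ => by
    simpa [Real.cos_arccos h₁ h₂] using h (Real.arccos c)
  have h₁ := hc 1 (by norm_num) (by norm_num)
  have h₂ := hc (1 / 2) (by norm_num) (by norm_num)
  have h₃ := hc 0 (by norm_num) (by norm_num)
  have h₄ := hc (-(1 / 2)) (by norm_num) (by norm_num)
  have h₅ := hc (-1) (by norm_num) (by norm_num)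
  have hA₄ : A₄ = 0 := by
    have : k ^ 4 * A₄ = 0 := by
      linear_combination (2 / 3) * (h₁ - 4 * h₂ + 6 * h₃ - 4 * h₄ + h₅)
    simpa [hk] using this
  subst hA₄
  have hA₃ : A₃ = 0 := by
    have : k ^ 3 * A₃ = 0 := by
      linear_combination -(2 / 3) * (h₁ - 2 * h₂ + 2 * h₄ - h₅)
    simpa [hk] using this
  subst hA₃
  have hA₂ : A₂ = 0 := by
    have : k ^ 2 * A₂ = 0 := by
      linear_combination (1 / 2) * (h₁ - 2 * h₃ + h₅)
    simpa [hk] using this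
  exact ⟨hA₂, rfl, rfl⟩

/-- The numerator of the second Gaussian curvature of a canal surface as a function of `(s, t)`. -/
theorem canal_secondGaussian_numerator {r p ρ k τ : ℝ → ℝ}
    (hr : ∀ s, HasDerivAt r (p s) s) (hp : ∀ s, HasDerivAt p (ρ s) s)
    (hρ : Differentiable ℝ ρ) (hk : Differentiable ℝ k) (hτ : Differentiable ℝ τ)
    (hΛ : ∀ s, 1 - p s ^ 2 ≠ 0)
    {e f g es et ett fs ft fst gs gt gss : ℝ → ℝ → ℝ}
    (he : ∀ s t, e s t = ((1 - p s ^ 2) - r s * (ρ s - k s * Real.cos t))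
      * (ρ s - k s * Real.cos t) / (1 - p s ^ 2)
      - r s * (p s * (k s * Real.sin t) + (1 - p s ^ 2) * τ s) ^ 2 / (1 - p s ^ 2))
    (hf : ∀ s t, f s t = r s * (p s * (k s * Real.sin t) + (1 - p s ^ 2) * τ s))
    (hg : ∀ s t, g s t = -r s * (1 - p s ^ 2))
    (hes : ∀ s t, es s t = deriv (fun u => e u t) s)
    (het : ∀ s t, et s t = deriv (fun u => e s u) t)
    (hett : ∀ s t, ett s t = deriv (fun u => et s u) t)
    (hfs : ∀ s t, fs s t = deriv (fun u => f u t) s)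
    (hft : ∀ s t, ft s t = deriv (fun u => f s u) t)
    (hfst : ∀ s t, fst s t = deriv (fun u => fs s u) t)
    (hgs : ∀ s t, gs s t = deriv (fun u => g u t) s)
    (hgt : ∀ s t, gt s t = deriv (fun u => g s u) t)
    (hgss : ∀ s t, gss s t = deriv (fun u => gs u t) s)
    {s : ℝ} (hks : k s ≠ 0) (t : ℝ) :
    Matrix.det !![-(1 / 2) * ett s t + fst s t - (1 / 2) * gss s t,
          (1 / 2) * es s t, fs s t - (1 / 2) * et s t;
          ft s t - (1 / 2) * gs s t, e s t, f s t;
          (1 / 2) * gt s t, f s t, g s t] -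
        Matrix.det !![0, (1 / 2) * et s t, (1 / 2) * gs s t;
          (1 / 2) * et s t, e s t, f s t;
          (1 / 2) * gs s t, f s t, g s t]
      = -r s ^ 3 * (ρ s - k s * Real.cos t) ^ 4
        + 3 / 2 * r s ^ 2 * (1 - p s ^ 2) * (ρ s - k s * Real.cos t) ^ 3
        - 1 / 4 * r s * (1 - p s ^ 2) ^ 2 * (ρ s - k s * Real.cos t) ^ 2
        + (1 / 2 * r s * (1 - p s ^ 2) * p s ^ 2 * ρ s
          + 1 / 4 * r s * (1 - p s ^ 2) ^ 2 * p s * (deriv k s / k s)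
          - 1 / 2 * r s * (1 - p s ^ 2) ^ 2 * ρ s
          + 1 / 4 * p s ^ 2 * (1 - p s ^ 2) ^ 2) * (ρ s - k s * Real.cos t)
        + 1 / 4 * r s * (1 - p s ^ 2) ^ 2
          * (p s * (deriv ρ s - deriv k s / k s * ρ s) - (k s ^ 2 - ρ s ^ 2))
        + 1 / 4 * r s * (1 - p s ^ 2) ^ 2 * p s * k s * τ s * Real.sin t := by
  have hρ' : ∀ s, HasDerivAt ρ (deriv ρ s) s := fun s => (hρ s).hasDerivAt
  have hk' : ∀ s, HasDerivAt k (deriv k s) s := fun s => (hk s).hasDerivAt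
  have hτ' : ∀ s, HasDerivAt τ (deriv τ s) s := fun s => (hτ s).hasDerivAt
  have hΛs : ∀ s, HasDerivAt (fun s => 1 - p s ^ 2) (-2 * p s * ρ s) s := fun s =>
    (((hp s).pow 2).const_sub 1).congr_deriv (by norm_num)
  have hcos : ∀ t, HasDerivAt Real.cos (-Real.sin t) t := Real.hasDerivAt_cos
  have hsin : ∀ t, HasDerivAt Real.sin (Real.cos t) t := Real.hasDerivAt_sin
  have hut : ∀ s t, HasDerivAt (fun t => ρ s - k s * Real.cos t) (k s * Real.sin t) t :=
    fun s t => (((hcos t).const_mul (k s)).const_sub (ρ s)).congr_deriv (by ring)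
  have hus : ∀ s t, HasDerivAt (fun s => ρ s - k s * Real.cos t)
      (deriv ρ s - deriv k s * Real.cos t) s :=
    fun s t => (hρ' s).sub ((hk' s).mul_const (Real.cos t))
  have hWt : ∀ s t, HasDerivAt (fun t => p s * (k s * Real.sin t) + (1 - p s ^ 2) * τ s)
      (p s * (k s * Real.cos t)) t := fun s t =>
    (((hsin t).const_mul (k s)).const_mul (p s)).add_const _
  have hWs : ∀ s t, HasDerivAt (fun s => p s * (k s * Real.sin t) + (1 - p s ^ 2) * τ s)
      (ρ s * (k s * Real.sin t) + p s * (deriv k s * Real.sin t)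
        + (-2 * p s * ρ s) * τ s + (1 - p s ^ 2) * deriv τ s) s := fun s t =>
    (((hp s).mul ((hk' s).mul_const _)).add ((hΛs s).mul (hτ' s))).congr_deriv (by ring)
  have hgs' : ∀ s t, gs s t = -(p s * (1 - p s ^ 2) + r s * (-2 * p s * ρ s)) := fun s t => by
    rw [hgs]
    simp only [hg]
    exact (((hr s).neg.mul (hΛs s)).congr_deriv (by simp only [Pi.neg_apply]; ring)).deriv
  have hfs' : ∀ s t, fs s t = p s * (p s * (k s * Real.sin t) + (1 - p s ^ 2) * τ s)
      + r s * (ρ s * (k s * Real.sin t) + p s * (deriv k s * Real.sin t)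
        + (-2 * p s * ρ s) * τ s + (1 - p s ^ 2) * deriv τ s) := fun s t => by
    rw [hfs]
    simp only [hf]
    exact ((hr s).mul (hWs s t)).deriv
  have het' : ∀ s t, et s t
      = ((1 - p s ^ 2) - 2 * r s * (ρ s - k s * Real.cos t)) * (k s * Real.sin t) / (1 - p s ^ 2)
        - r s * (2 * (p s * (k s * Real.sin t) + (1 - p s ^ 2) * τ s)
          * (p s * (k s * Real.cos t))) / (1 - p s ^ 2) := fun s t => by
    rw [het]
    simp only [he]
    exact ((((((hut s t).const_mul (r s)).const_sub (1 - p s ^ 2)).mul (hut s t)).div_const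
      (1 - p s ^ 2)).sub ((((hWt s t).pow 2).const_mul (r s)).div_const (1 - p s ^ 2))
      |>.congr_deriv (by norm_num; ring)).deriv
  have hgt' : gt s t = 0 := by
    rw [hgt]
    simp only [hg]
    exact deriv_const _ _
  have hm : deriv k s / k s * k s = deriv k s := div_mul_cancel₀ _ hks
  rw [hgt']
  refine canal_secondGaussian_numerator_algebra
    (σ := deriv ρ s) (m := deriv k s / k s)
    (Ws := ρ s * (k s * Real.sin t) + p s * (deriv k s * Real.sin t)
      + (-2 * p s * ρ s) * τ s + (1 - p s ^ 2) * deriv τ s)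
    (hΛ s) (Real.sin_sq t) rfl rfl rfl rfl rfl rfl
    rfl rfl rfl rfl rfl rfl rfl (he s t) (hf s t) (hg s t) (het' s t) ?_ ?_ ?_ ?_ ?_ (hgs' s t) ?_
  · rw [hett]
    simp only [het']
    have h₁ := ((((hut s t).const_mul (2 * r s)).const_sub (1 - p s ^ 2)).mul
      ((hsin t).const_mul (k s))).div_const (1 - p s ^ 2)
    have h₂ := (((((hWt s t).const_mul 2).mul (((hcos t).const_mul (k s)).const_mul
      (p s))).const_mul (r s)).div_const (1 - p s ^ 2))
    exact ((h₁.sub h₂).congr_deriv (by ring)).deriv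
  · rw [hes]
    simp only [he]
    have h₁ := (((hΛs s).sub ((hr s).mul (hus s t))).mul (hus s t)).div (hΛs s) (hΛ s)
    have h₂ := ((hr s).mul ((hWs s t).pow 2)).div (hΛs s) (hΛ s)
    refine ((h₁.sub h₂).congr_deriv ?_).deriv
    simp only [hm]
    norm_num
    ring
  · exact hfs' s t
  · rw [hft]
    simp only [hf]
    exact ((hWt s t).const_mul (r s)).deriv
  · rw [hfst]
    simp only [hfs']
    have h₁ := (hWt s t).const_mul (p s)
    have h₂ := (((((hsin t).const_mul (k s)).const_mul (ρ s)).add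
      (((hsin t).const_mul (deriv k s)).const_mul (p s))).add_const
      ((-2 * p s * ρ s) * τ s)).add_const ((1 - p s ^ 2) * deriv τ s) |>.const_mul (r s)
    refine ((h₁.add h₂).congr_deriv ?_).deriv
    linear_combination -r s * p s * Real.cos t * hm
  · rw [hgss]
    simp only [hgs']
    refine ((((hp s).mul (hΛs s)).add ((hr s).mul (((hp s).const_mul (-2)).mul
      (hρ' s)))).neg.congr_deriv ?_).deriv
    simp only [Pi.mul_apply]
    ring

/-- Derivative of a combination of Frenet frame fields. -/
theorem hasDerivAt_frame {V : Type*} [NormedAddCommGroup V] [NormedSpace ℝ V]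
    {T N B : ℝ → V} {κ τ s : ℝ} (hT : HasDerivAt T (κ • N s) s)
    (hN : HasDerivAt N ((-κ) • T s + τ • B s) s) (hB : HasDerivAt B ((-τ) • N s) s)
    {x y z : ℝ → ℝ} {x' y' z' : ℝ}
    (hx : HasDerivAt x x' s) (hy : HasDerivAt y y' s) (hz : HasDerivAt z z' s) :
    HasDerivAt (fun u => x u • T u + y u • N u + z u • B u)
      ((x' - κ * y s) • T s + (y' + κ * x s - τ * z s) • N s + (z' + τ * y s) • B s) s :=
  (((hx.smul hT).add (hy.smul hN)).add (hz.smul hB)).congr_deriv (by module)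

/-- Inner product in coordinates with respect to an orthonormal triple. -/
theorem inner_frame {V : Type*} [NormedAddCommGroup V] [InnerProductSpace ℝ V] {T N B : V}
    (hT : ‖T‖ = 1) (hN : ‖N‖ = 1) (hB : ‖B‖ = 1)
    (hTN : ⟪T, N⟫ = 0) (hTB : ⟪T, B⟫ = 0) (hNB : ⟪N, B⟫ = 0) (x y z x' y' z' : ℝ) :
    ⟪x • T + y • N + z • B, x' • T + y' • N + z' • B⟫ = x * x' + y * y' + z * z' := by
  simp only [inner_add_left, inner_add_right, real_inner_smul_left, real_inner_smul_right,
    real_inner_self_eq_norm_sq, hT, hN, hB, hTN, hTB, hNB, real_inner_comm T N,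
    real_inner_comm T B, real_inner_comm N B]
  ring

/-- If two moving vectors stay orthogonal, the derivative moves from one factor to the other. -/
theorem inner_deriv_eq_neg_of_orthogonal {V : Type*} [NormedAddCommGroup V]
    [InnerProductSpace ℝ V] {X Y : ℝ → V} {X' Y' : V} {s : ℝ} (hX : HasDerivAt X X' s)
    (hY : HasDerivAt Y Y' s) (h : ∀ u, ⟪X u, Y u⟫ = 0) : ⟪X', Y s⟫ = -⟪X s, Y'⟫ := by
  have h₁ := hX.inner ℝ hY
  simp only [h] at h₁
  linarith [h₁.unique (hasDerivAt_const s (0 : ℝ))]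

/-- The linear Weingarten relation of a canal surface, cleared of denominators. -/
theorem weingarten_clear_denominators {a b d r u P Λ M : ℝ} (hr : r ≠ 0) (hP : P ≠ 0)
    (hu : u ≠ 0)
    (h : a * (r * P * (2 * r * u - Λ) / (2 * (r ^ 2 * P ^ 2)))
      + b * ((-(r * P * u))⁻¹ ^ 2 * M) = d) :
    a * (2 * r * u - Λ) * r * P * u ^ 2 + 2 * b * M = 2 * d * r ^ 2 * P ^ 2 * u ^ 2 := by
  rw [← h]
  field_simp

theorem HKII_linear_Weingarten_straight_center
    (α T N B : ℝ → EuclideanSpace ℝ (Fin 3)) (κ τ r : ℝ → ℝ)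
    (hα : ContDiff ℝ (⊤ : ℕ∞) α) (hT : ContDiff ℝ (⊤ : ℕ∞) T)
    (hN : ContDiff ℝ (⊤ : ℕ∞) N) (hB : ContDiff ℝ (⊤ : ℕ∞) B)
    (hκ : ContDiff ℝ (⊤ : ℕ∞) κ) (hτ : ContDiff ℝ (⊤ : ℕ∞) τ)
    (hr : ContDiff ℝ (⊤ : ℕ∞) r)
    (hTα : ∀ s, T s = deriv α s)
    (hT1 : ∀ s, ‖T s‖ = 1) (hN1 : ∀ s, ‖N s‖ = 1) (hB1 : ∀ s, ‖B s‖ = 1)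
    (hTN : ∀ s, ⟪T s, N s⟫ = 0) (hTB : ∀ s, ⟪T s, B s⟫ = 0)
    (hNB : ∀ s, ⟪N s, B s⟫ = 0)
    (hT' : ∀ s, deriv T s = κ s • N s)
    (hN' : ∀ s, deriv N s = (-κ s) • T s + τ s • B s)
    (hB' : ∀ s, deriv B s = (-τ s) • N s)
    (hrpos : ∀ s, 0 < r s) (hr1 : ∀ s, |deriv r s| < 1)
    (R Q : ℝ → ℝ)
    (hR : ∀ s, R s = r s * deriv r s)
    (hQ : ∀ s, Q s = r s * Real.sqrt (1 - (deriv r s) ^ 2))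
    (C : ℝ → ℝ → EuclideanSpace ℝ (Fin 3))
    (hC : ∀ s t, C s t = α s - R s • T s - (Q s * Real.cos t) • N s
      + (Q s * Real.sin t) • B s)
    (Cs Ct : ℝ → ℝ → EuclideanSpace ℝ (Fin 3))
    (hCs : ∀ s t, Cs s t = deriv (fun u => C u t) s)
    (hCt : ∀ s t, Ct s t = deriv (fun u => C s u) t)
    (E F G : ℝ → ℝ → ℝ)
    (hE : ∀ s t, E s t = ⟪Cs s t, Cs s t⟫)
    (hF : ∀ s t, F s t = ⟪Cs s t, Ct s t⟫)
    (hG : ∀ s t, G s t = ⟪Ct s t, Ct s t⟫)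
    (n : ℝ → ℝ → EuclideanSpace ℝ (Fin 3))
    (hn : ∀ s t, n s t = (r s)⁻¹ • (C s t - α s))
    (Css Cst Ctt : ℝ → ℝ → EuclideanSpace ℝ (Fin 3))
    (hCss : ∀ s t, Css s t = deriv (fun u => Cs u t) s)
    (hCst : ∀ s t, Cst s t = deriv (fun u => Cs s u) t)
    (hCtt : ∀ s t, Ctt s t = deriv (fun u => Ct s u) t)
    (e f g : ℝ → ℝ → ℝ)
    (he : ∀ s t, e s t = ⟪Css s t, n s t⟫)
    (hf : ∀ s t, f s t = ⟪Cst s t, n s t⟫)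
    (hg : ∀ s t, g s t = ⟪Ctt s t, n s t⟫)
    (H : ℝ → ℝ → ℝ)
    (hH : ∀ s t, H s t = (E s t * g s t - 2 * F s t * f s t + G s t * e s t)
      / (2 * (E s t * G s t - F s t ^ 2)))
    (es et ett fs ft fst gs gt gss : ℝ → ℝ → ℝ)
    (hes : ∀ s t, es s t = deriv (fun u => e u t) s)
    (het : ∀ s t, et s t = deriv (fun u => e s u) t)
    (hett : ∀ s t, ett s t = deriv (fun u => et s u) t)
    (hfs : ∀ s t, fs s t = deriv (fun u => f u t) s)
    (hft : ∀ s t, ft s t = deriv (fun u => f s u) t)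
    (hfst : ∀ s t, fst s t = deriv (fun u => fs s u) t)
    (hgs : ∀ s t, gs s t = deriv (fun u => g u t) s)
    (hgt : ∀ s t, gt s t = deriv (fun u => g s u) t)
    (hgss : ∀ s t, gss s t = deriv (fun u => gs u t) s)
    (KII : ℝ → ℝ → ℝ)
    (hKII : ∀ s t, KII s t = (e s t * g s t - f s t ^ 2)⁻¹ ^ 2 *
      (Matrix.det !![-(1 / 2) * ett s t + fst s t - (1 / 2) * gss s t,
          (1 / 2) * es s t, fs s t - (1 / 2) * et s t;
          ft s t - (1 / 2) * gs s t, e s t, f s t;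
          (1 / 2) * gt s t, f s t, g s t] -
        Matrix.det !![0, (1 / 2) * et s t, (1 / 2) * gs s t;
          (1 / 2) * et s t, e s t, f s t;
          (1 / 2) * gs s t, f s t, g s t]))
    (a b d : ℝ) (hb : b ≠ 0)
    (hreg : ∀ s t, E s t * G s t - F s t ^ 2 ≠ 0)
    (hreg2 : ∀ s t, e s t * g s t - f s t ^ 2 ≠ 0)
    (hlin : ∀ s t : ℝ, a * H s t + b * KII s t = d)
    :
    ∀ s : ℝ, κ s = 0 := by
  obtain ⟨hrd, hps⟩ := contDiff_infty_iff_deriv.1 hr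
  obtain ⟨hpd, hρs⟩ := contDiff_infty_iff_deriv.1 hps
  have hρd := (contDiff_infty_iff_deriv.1 hρs).1
  obtain ⟨p, hp⟩ : ∃ p, p = deriv r := ⟨_, rfl⟩
  obtain ⟨ρ, hρ⟩ : ∃ ρ, ρ = deriv p := ⟨_, rfl⟩
  simp only [← hp] at hr1 hR hQ hps hpd hρs hρd
  simp only [← hρ] at hρs hρd
  have hΛ : ∀ s, 0 < 1 - p s ^ 2 := fun s => by
    have := (sq_lt_one_iff_abs_lt_one (p s)).2 (hr1 s)
    linarith
  obtain ⟨q, hq⟩ : ∃ q : ℝ → ℝ, q = fun s => Real.sqrt (1 - p s ^ 2) := ⟨_, rfl⟩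
  have hqpos : ∀ s, 0 < q s := fun s => by rw [hq]; exact Real.sqrt_pos.2 (hΛ s)
  have hq2 : ∀ s, q s ^ 2 = 1 - p s ^ 2 := fun s => by rw [hq]; exact Real.sq_sqrt (hΛ s).le
  have hqs : ContDiff ℝ (⊤ : ℕ∞) q := by
    rw [hq]
    exact (contDiff_const.sub (hps.pow 2)).sqrt fun s => (hΛ s).ne'
  obtain ⟨hqd, hq₁s⟩ := contDiff_infty_iff_deriv.1 hqs
  have hq₁d := (contDiff_infty_iff_deriv.1 hq₁s).1
  have hr' : ∀ s, HasDerivAt r (p s) s := fun s => by rw [hp]; exact (hrd s).hasDerivAt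
  have hp' : ∀ s, HasDerivAt p (ρ s) s := fun s => by rw [hρ]; exact (hpd s).hasDerivAt
  have hq' : ∀ s, HasDerivAt q (deriv q s) s := fun s => (hqd s).hasDerivAt
  have hqq : ∀ s, q s * deriv q s = -(p s * ρ s) := fun s => by
    have h₁ : HasDerivAt (fun s => q s ^ 2) _ s := (hq' s).pow 2
    simp only [hq2] at h₁
    have h₂ := h₁.unique (((hp' s).pow 2).const_sub 1)
    norm_num at h₂
    linarith
  have hκd : Differentiable ℝ κ := hκ.differentiable (by simp)
  have hτd : Differentiable ℝ τ := hτ.differentiable (by simp)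
  have hTd : Differentiable ℝ T := hT.differentiable (by simp)
  have hNd : Differentiable ℝ N := hN.differentiable (by simp)
  have hBd : Differentiable ℝ B := hB.differentiable (by simp)
  have hα' : ∀ s, HasDerivAt α (T s) s := fun s => by
    rw [hTα]; exact (hα.differentiable (by simp) s).hasDerivAt
  have hTs : ∀ s, HasDerivAt T (κ s • N s) s := fun s => hT' s ▸ (hTd s).hasDerivAt
  have hNs : ∀ s, HasDerivAt N ((-κ s) • T s + τ s • B s) s := fun s =>
    hN' s ▸ (hNd s).hasDerivAt
  have hBs : ∀ s, HasDerivAt B ((-τ s) • N s) s := fun s => hB' s ▸ (hBd s).hasDerivAt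
  have hin := fun s => inner_frame (hT1 s) (hN1 s) (hB1 s) (hTN s) (hTB s) (hNB s)
  have hcos : ∀ t, HasDerivAt Real.cos (-Real.sin t) t := Real.hasDerivAt_cos
  have hsin : ∀ t, HasDerivAt Real.sin (Real.cos t) t := Real.hasDerivAt_sin
  have hcs : ∀ t, Real.sin t ^ 2 + Real.cos t ^ 2 = 1 := Real.sin_sq_add_cos_sq
  -- the unit normal and its derivatives
  have hn' : ∀ s t, n s t
      = (-p s) • T s + (-(q s * Real.cos t)) • N s + (q s * Real.sin t) • B s := fun s t => by
    have h₁ : C s t - α s = r s •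
        ((-p s) • T s + (-(q s * Real.cos t)) • N s + (q s * Real.sin t) • B s) := by
      rw [hC, hR, hQ, hq]
      module
    rw [hn, h₁, inv_smul_smul₀ (hrpos s).ne']
  have hCn : ∀ s t, C s t = α s + r s • n s t := fun s t => by
    rw [hn, smul_inv_smul₀ (hrpos s).ne']
    abel
  have hns : ∀ s t, HasDerivAt (fun u => n u t)
      ((-ρ s + κ s * q s * Real.cos t) • T s
        + (-(deriv q s * Real.cos t) - κ s * p s - τ s * (q s * Real.sin t)) • N s
        + (deriv q s * Real.sin t - τ s * (q s * Real.cos t)) • B s) s := fun s t => by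
    simp only [hn']
    refine (hasDerivAt_frame (hTs s) (hNs s) (hBs s) (hp' s).neg
      ((hq' s).mul_const (Real.cos t)).neg ((hq' s).mul_const (Real.sin t))).congr_deriv ?_
    simp only [Pi.neg_apply]
    module
  have hnt : ∀ s t, HasDerivAt (fun u => n s u)
      ((0 : ℝ) • T s + (q s * Real.sin t) • N s + (q s * Real.cos t) • B s) t := fun s t => by
    simp only [hn']
    exact ((((((hcos t).const_mul (q s)).neg.smul_const (N s)).const_add ((-p s) • T s))).add
      (((hsin t).const_mul (q s)).smul_const (B s))).congr_deriv (by module)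
  -- the tangent vectors
  have hCs' : ∀ s t, Cs s t
      = (1 - p s ^ 2 - r s * (ρ s - κ s * q s * Real.cos t)) • T s
        + (-(p s * q s * Real.cos t)
          + r s * (-(deriv q s * Real.cos t) - κ s * p s - τ s * (q s * Real.sin t))) • N s
        + (p s * q s * Real.sin t
          + r s * (deriv q s * Real.sin t - τ s * (q s * Real.cos t))) • B s := fun s t => by
    rw [hCs]
    simp only [hCn]
    refine ((hα' s).add ((hr' s).smul (hns s t)) |>.congr_deriv ?_).deriv
    rw [hn']
    module
  have hCt' : ∀ s t, Ct s t = (0 : ℝ) • T s + (r s * (q s * Real.sin t)) • N s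
      + (r s * (q s * Real.cos t)) • B s := fun s t => by
    rw [hCt]
    simp only [hCn]
    exact (((hnt s t).const_smul (r s)).const_add (α s) |>.congr_deriv (by module)).deriv
  have hCsd : ∀ t, Differentiable ℝ fun s => Cs s t := fun t => by
    simp only [hCs']
    fun_prop
  have hCsdt : ∀ s, Differentiable ℝ fun t => Cs s t := fun s => by
    simp only [hCs']
    fun_prop
  have hCtd : ∀ s, Differentiable ℝ fun t => Ct s t := fun s => by
    simp only [hCt']
    fun_prop
  have hCsn : ∀ s t, ⟪Cs s t, n s t⟫ = 0 := fun s t => by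
    rw [hCs', hn', hin]
    linear_combination (r s * deriv q s * q s + p s * q s ^ 2) * hcs t
      + r s * hqq s + p s * hq2 s
  have hCtn : ∀ s t, ⟪Ct s t, n s t⟫ = 0 := fun s t => by
    rw [hCt', hn', hin]
    ring
  -- the fundamental forms
  have hG' : ∀ s t, G s t = r s ^ 2 * (1 - p s ^ 2) := fun s t => by
    rw [hG, hCt', hin]
    linear_combination r s ^ 2 * q s ^ 2 * hcs t + r s ^ 2 * hq2 s
  have hg' : ∀ s t, g s t = -r s * (1 - p s ^ 2) := fun s t => by
    have h₁ := ((hCtd s) t).hasDerivAt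
    rw [← hCtt] at h₁
    rw [hg, inner_deriv_eq_neg_of_orthogonal h₁ (hnt s t) (hCtn s), hCt', hin]
    linear_combination -r s * q s ^ 2 * hcs t - r s * hq2 s
  obtain ⟨k, hk⟩ : ∃ k : ℝ → ℝ, k = fun s => κ s * q s := ⟨_, rfl⟩
  have hkd : Differentiable ℝ k := by rw [hk]; fun_prop
  have hk' : ∀ s, k s = κ s * q s := fun s => by rw [hk]
  have hf' : ∀ s t, f s t = r s * (p s * (k s * Real.sin t) + (1 - p s ^ 2) * τ s) :=
      fun s t => by
    have h₁ := ((hCsdt s) t).hasDerivAt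
    rw [← hCst] at h₁
    rw [hf, inner_deriv_eq_neg_of_orthogonal h₁ (hnt s t) (hCsn s), hCs', hin, hk']
    linear_combination r s * q s ^ 2 * τ s * hcs t + r s * τ s * hq2 s
  have hF' : ∀ s t, F s t = -r s * f s t := fun s t => by
    rw [hF, hf', hCs', hCt', hin, hk']
    linear_combination -r s ^ 2 * q s ^ 2 * τ s * hcs t - r s ^ 2 * τ s * hq2 s
  have hE' : ∀ s t, E s t = ((1 - p s ^ 2 - r s * (ρ s - k s * Real.cos t)) ^ 2
      + r s ^ 2 * (p s * (k s * Real.sin t) + (1 - p s ^ 2) * τ s) ^ 2) / (1 - p s ^ 2) :=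
      fun s t => by
    rw [eq_div_iff (hΛ s).ne', hE, hCs', hin, ← hk']
    have hy : (-(p s * q s * Real.cos t)
          + r s * (-(deriv q s * Real.cos t) - κ s * p s - τ s * (q s * Real.sin t))) * q s
        = -(p s * (1 - p s ^ 2 - r s * ρ s)) * Real.cos t - r s * p s * k s
          - r s * (1 - p s ^ 2) * τ s * Real.sin t := by
      rw [hk']
      linear_combination (-p s * Real.cos t - r s * τ s * Real.sin t) * hq2 s
        - r s * Real.cos t * hqq s
    have hz : (p s * q s * Real.sin t
          + r s * (deriv q s * Real.sin t - τ s * (q s * Real.cos t))) * q s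
        = p s * (1 - p s ^ 2 - r s * ρ s) * Real.sin t
          - r s * (1 - p s ^ 2) * τ s * Real.cos t := by
      linear_combination (p s * Real.sin t - r s * τ s * Real.cos t) * hq2 s
        + r s * Real.sin t * hqq s
    have h₁ : ∀ x y z : ℝ, (x * x + y * y + z * z) * (1 - p s ^ 2)
        = x ^ 2 * (1 - p s ^ 2) + (y * q s) ^ 2 + (z * q s) ^ 2 := fun x y z => by
      rw [← hq2]; ring
    rw [h₁, hy, hz]
    linear_combination ((p s * (1 - p s ^ 2 - r s * ρ s)) ^ 2
      + (r s * (1 - p s ^ 2) * τ s) ^ 2 - (r s * p s * k s) ^ 2) * hcs t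
  have he' : ∀ s t, e s t = ((1 - p s ^ 2) - r s * (ρ s - k s * Real.cos t))
      * (ρ s - k s * Real.cos t) / (1 - p s ^ 2)
      - r s * (p s * (k s * Real.sin t) + (1 - p s ^ 2) * τ s) ^ 2 / (1 - p s ^ 2) :=
      fun s t => by
    have h₁ := ((hCsd t) s).hasDerivAt
    rw [← hCss] at h₁
    have h₂ : r s * e s t
        = (1 - p s ^ 2 - r s * (ρ s - k s * Real.cos t)) - E s t := by
      rw [he, inner_deriv_eq_neg_of_orthogonal h₁ (hns s t) (fun u => hCsn u t), hE]
      have h₃ := hCsn s t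
      rw [hCs', hn', hin] at h₃
      rw [hCs', hin, hin, hk']
      linear_combination p s * h₃
    refine mul_left_cancel₀ (hrpos s).ne' ?_
    rw [h₂, hE']
    have := (hΛ s).ne'
    field_simp
    ring
  -- comparison of the top coefficients
  intro s
  by_contra hκs
  have hks : k s ≠ 0 := by rw [hk']; exact mul_ne_zero hκs (hqpos s).ne'
  have hr0 := (hrpos s).ne'
  have hΛ0 := (hΛ s).ne'
  have hnum := canal_secondGaussian_numerator hr' hp' hρd hkd hτd (fun s => (hΛ s).ne')
    he' hf' hg' hes het hett hfs hft hfst hgs hgt hgss hks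
  have hD : ∀ t, e s t * g s t - f s t ^ 2 = -(r s
      * (1 - p s ^ 2 - r s * (ρ s - k s * Real.cos t)) * (ρ s - k s * Real.cos t)) := fun t => by
    rw [he', hf', hg']
    field_simp
    ring
  have hW : ∀ t, E s t * G s t - F s t ^ 2
      = r s ^ 2 * (1 - p s ^ 2 - r s * (ρ s - k s * Real.cos t)) ^ 2 := fun t => by
    rw [hE', hF', hf', hG']
    field_simp
    ring
  have hHnum : ∀ t, E s t * g s t - 2 * F s t * f s t + G s t * e s t
      = r s * (1 - p s ^ 2 - r s * (ρ s - k s * Real.cos t))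
        * (2 * r s * (ρ s - k s * Real.cos t) - (1 - p s ^ 2)) := fun t => by
    rw [hE', hF', hf', hG', hg', he']
    field_simp
    ring
  have hlin' := fun t => hlin s t
  simp only [hH, hKII, hHnum, hW, hD, hnum] at hlin'
  have hclear := fun t => weingarten_clear_denominators hr0
    (fun h => hreg s t (by rw [hW, h]; ring)) (fun h => hreg2 s t (by rw [hD, h]; ring)) (hlin' t)
  obtain ⟨h₂, h₃, h₄⟩ := quartic_cos_coeff_eq_zero (ρ := ρ s) (k := k s)
    (A₄ := -2 * r s ^ 3 * (a + b + r s * d))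
    (A₃ := r s ^ 2 * (1 - p s ^ 2) * (3 * a + 3 * b + 4 * r s * d))
    (A₂ := -r s * (1 - p s ^ 2) ^ 2 * (a + b / 2 + 2 * r s * d))
    (A₁ := 2 * b * (1 / 2 * r s * (1 - p s ^ 2) * p s ^ 2 * ρ s
      + 1 / 4 * r s * (1 - p s ^ 2) ^ 2 * p s * (deriv k s / k s)
      - 1 / 2 * r s * (1 - p s ^ 2) ^ 2 * ρ s + 1 / 4 * p s ^ 2 * (1 - p s ^ 2) ^ 2))
    (A₀ := 2 * b * (1 / 4 * r s * (1 - p s ^ 2) ^ 2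
      * (p s * (deriv ρ s - deriv k s / k s * ρ s) - (k s ^ 2 - ρ s ^ 2))))
    hks fun t => by
      have h₁ := hclear t
      have h₂ := hclear (-t)
      rw [Real.cos_neg, Real.sin_neg] at h₂
      linear_combination (h₁ + h₂) / 2
  have h₂' : a + b / 2 + 2 * r s * d = 0 := by simpa [hr0, hΛ0] using h₂
  have h₃' : 3 * a + 3 * b + 4 * r s * d = 0 := by simpa [hr0, hΛ0] using h₃
  have h₄' : a + b + r s * d = 0 := by simpa [hr0] using h₄
  exact hb (by linarith)
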